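/- arXiv:2410.04711 — 4 statements merged into one kernel-verified Lean document; each statement's English description precedes it below -/
import Mathlib

section
/- Let U₁ and U₂ be 2^(N-1) × 2^(N-1) unitary matrices. If the block-diagonal unitary U₁ ⊕ U₂ lies in the Clifford Hierarchy on N qubits (i.e., in CH_k for some finite k ≥ 1), then U₁ lies in the Clifford Hierarchy on N-1 qubits and U₂ lies in the Clifford Hierarchy on N-1 qubits (each in CH_j for some finite j ≥ 1). -/
open Matrix

noncomputable section

/-- `QMat n` : operators on `n` qubits, identified with `2^n × 2^n` complex matrices
(indexed by bit strings `Fin n → Fin 2`). -/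
abbrev QMat (n : ℕ) := Matrix (Fin n → Fin 2) (Fin n → Fin 2) ℂ

/-- The single-qubit Pauli `X` matrix. -/
def σX : Matrix (Fin 2) (Fin 2) ℂ := !![0, 1; 1, 0]

/-- The single-qubit Pauli `Y` matrix. -/
def σY : Matrix (Fin 2) (Fin 2) ℂ := !![0, -Complex.I; Complex.I, 0]

/-- The single-qubit Pauli `Z` matrix. -/
def σZ : Matrix (Fin 2) (Fin 2) ℂ := !![1, 0; 0, -1]

/-- The set `{I, X, Y, Z}` of single-qubit Pauli matrices. -/
def pauliSet : Set (Matrix (Fin 2) (Fin 2) ℂ) := {1, σX, σY, σZ}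

/-- The tensor (Kronecker) product `σ 0 ⊗ ⋯ ⊗ σ (n-1)` of single-qubit matrices. -/
def tensorStr {n : ℕ} (σ : Fin n → Matrix (Fin 2) (Fin 2) ℂ) : QMat n :=
  fun f g => ∏ i, σ i (f i) (g i)

/-- The `n`-qubit Pauli group `P_n`: all `c • (σ₁ ⊗ ⋯ ⊗ σₙ)` with
`σᵢ ∈ {I, X, Y, Z}` and `c ∈ {1, -1, i, -i}`. -/
def PauliGroup (n : ℕ) : Set (QMat n) :=
  {P | ∃ c ∈ ({1, -1, Complex.I, -Complex.I} : Set ℂ),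
    ∃ σ : Fin n → Matrix (Fin 2) (Fin 2) ℂ, (∀ i, σ i ∈ pauliSet) ∧ P = c • tensorStr σ}

/-- Kronecker product `M ⊗ A` of a single-qubit matrix `M` with an `n`-qubit matrix `A`
(the single qubit is the first/topmost factor). -/
def kron {n : ℕ} (M : Matrix (Fin 2) (Fin 2) ℂ) (A : QMat n) : QMat (n + 1) :=
  fun f g => M (f 0) (g 0) * A (fun i => f i.succ) (fun i => g i.succ)

/-- The block-diagonal direct sum `A ⊕ B = |0⟩⟨0| ⊗ A + |1⟩⟨1| ⊗ B`. -/
def dSum {n : ℕ} (A B : QMat n) : QMat (n + 1) :=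
  kron !![1, 0; 0, 0] A + kron !![0, 0; 0, 1] B

/-- The Clifford Hierarchy on `n` qubits: `CH n 1 = P_n`, and for `k ≥ 2`,
`CH n k` consists of the unitaries `U` with `U P U† ∈ CH n (k-1)` for all `P ∈ P_n`.
(The index `0` is unused and set to `∅`.) -/
def CH (n : ℕ) : ℕ → Set (QMat n)
  | 0 => ∅
  | 1 => PauliGroup n
  | (k + 2) => {U | U ∈ unitary (QMat n) ∧ ∀ P ∈ PauliGroup n, U * P * star U ∈ CH n (k + 1)}

theorem dSum_cons {n : ℕ} (A B : QMat n) (a b : Fin 2) (f g : Fin n → Fin 2) :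
    dSum A B (Fin.cons a f) (Fin.cons b g) =
      (!![1, 0; 0, 0] : Matrix (Fin 2) (Fin 2) ℂ) a b * A f g
        + (!![0, 0; 0, 1] : Matrix (Fin 2) (Fin 2) ℂ) a b * B f g := by
  simp [dSum, kron]

theorem sum_cons {n : ℕ} (F : (Fin (n + 1) → Fin 2) → ℂ) :
    ∑ x, F x = ∑ f : Fin n → Fin 2, F (Fin.cons 0 f) + ∑ f : Fin n → Fin 2, F (Fin.cons 1 f) := by
  rw [← Equiv.sum_comp (Fin.consEquiv (fun _ : Fin (n + 1) => Fin 2)) F, Fintype.sum_prod_type,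
    Fin.sum_univ_two]
  rfl

theorem QMat_ext {n : ℕ} {A B : QMat (n + 1)}
    (h : ∀ a b f g, A (Fin.cons a f) (Fin.cons b g) = B (Fin.cons a f) (Fin.cons b g)) :
    A = B := by
  ext x y
  have := h (x 0) (y 0) (Fin.tail x) (Fin.tail y)
  simpa only [Fin.cons_self_tail] using this

theorem dSum_mul {n : ℕ} (A B C D : QMat n) : dSum A B * dSum C D = dSum (A * C) (B * D) := by
  apply QMat_ext
  intro a b f g
  rw [Matrix.mul_apply, sum_cons]
  simp only [dSum_cons]
  fin_cases a <;> fin_cases b <;> simp [Matrix.mul_apply]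

theorem dSum_star {n : ℕ} (A B : QMat n) : star (dSum A B) = dSum (star A) (star B) := by
  apply QMat_ext
  intro a b f g
  rw [Matrix.star_apply]
  simp only [dSum_cons, Matrix.star_apply]
  fin_cases a <;> fin_cases b <;> simp

theorem tensorStr_cons {n : ℕ} (σ : Fin (n + 1) → Matrix (Fin 2) (Fin 2) ℂ) (a b : Fin 2)
    (f g : Fin n → Fin 2) :
    tensorStr σ (Fin.cons a f) (Fin.cons b g) = σ 0 a b * tensorStr (Fin.tail σ) f g := by
  simp [tensorStr, Fin.prod_univ_succ, Fin.tail]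

theorem dSum_pauli {n : ℕ} {P : QMat n} (hP : P ∈ PauliGroup n) :
    dSum P P ∈ PauliGroup (n + 1) := by
  obtain ⟨c, hc, σ, hσ, rfl⟩ := hP
  refine ⟨c, hc, Fin.cons 1 σ, ?_, ?_⟩
  · intro i
    refine Fin.cases ?_ (fun j => ?_) i
    · simp [pauliSet]
    · simpa using hσ j
  · apply QMat_ext
    intro a b f g
    rw [dSum_cons, Matrix.smul_apply, Matrix.smul_apply, tensorStr_cons]
    fin_cases a <;> fin_cases b <;> simp

theorem pauli_of_unitary {n : ℕ} {U : QMat n} (hU : U ∈ unitary (QMat n)) {c d : ℂ}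
    (hc : c ∈ ({1, -1, Complex.I, -Complex.I} : Set ℂ)) (hd : d = 0 ∨ d = 1 ∨ d = -1)
    (σ : Fin n → Matrix (Fin 2) (Fin 2) ℂ) (hσ : ∀ i, σ i ∈ pauliSet)
    (h : ∀ f g, U f g = c * (d * tensorStr σ f g)) : U ∈ PauliGroup n := by
  rcases hd with rfl | rfl | rfl
  · exfalso
    have h0 : U = 0 := by ext f g; simp [h]
    have := (Unitary.mem_iff.1 hU).1
    rw [h0, mul_zero] at this
    exact zero_ne_one this
  · exact ⟨c, hc, σ, hσ, by ext f g; simp [h]⟩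
  · refine ⟨-c, ?_, σ, hσ, by ext f g; simp [h]⟩
    simp only [Set.mem_insert_iff, Set.mem_singleton_iff] at hc ⊢
    rcases hc with rfl | rfl | rfl | rfl <;> simp

theorem tensorStr_mul {n : ℕ} (σ τ : Fin n → Matrix (Fin 2) (Fin 2) ℂ) :
    tensorStr σ * tensorStr τ = tensorStr (fun i => σ i * τ i) := by
  ext f g
  simp only [Matrix.mul_apply, tensorStr, ← Finset.prod_mul_distrib]
  exact (Fintype.prod_sum (fun i j => σ i (f i) j * τ i j (g i))).symm

theorem tensorStr_one {n : ℕ} :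
    tensorStr (fun _ : Fin n => (1 : Matrix (Fin 2) (Fin 2) ℂ)) = 1 := by
  ext f g
  simp only [tensorStr, Matrix.one_apply, Finset.prod_ite_zero, Finset.prod_const_one,
    Finset.mem_univ, true_implies, funext_iff]

theorem tensorStr_star {n : ℕ} (σ : Fin n → Matrix (Fin 2) (Fin 2) ℂ) :
    star (tensorStr σ) = tensorStr (fun i => star (σ i)) := by
  ext f g
  simp [Matrix.star_apply, tensorStr]

theorem pauli_one_star {M : Matrix (Fin 2) (Fin 2) ℂ} (hM : M ∈ pauliSet) :
    star M = M ∧ M * M = 1 := by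
  simp only [pauliSet, Set.mem_insert_iff, Set.mem_singleton_iff] at hM
  rcases hM with rfl | rfl | rfl | rfl
  · simp
  all_goals
    constructor <;> ext i j <;> fin_cases i <;> fin_cases j <;>
      simp [σX, σY, σZ, Matrix.mul_apply, Matrix.star_apply]

theorem pauli_unitary {n : ℕ} {P : QMat n} (hP : P ∈ PauliGroup n) : P ∈ unitary (QMat n) := by
  obtain ⟨c, hc, σ, hσ, rfl⟩ := hP
  have hs : star (tensorStr σ) = tensorStr σ := by
    rw [tensorStr_star]
    congr 1
    funext i
    exact (pauli_one_star (hσ i)).1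
  have hm : tensorStr σ * tensorStr σ = 1 := by
    rw [tensorStr_mul, ← tensorStr_one]
    congr 1
    funext i
    exact (pauli_one_star (hσ i)).2
  have hcc : star c * c = 1 := by
    simp only [Set.mem_insert_iff, Set.mem_singleton_iff] at hc
    rcases hc with rfl | rfl | rfl | rfl <;> simp
  rw [Unitary.mem_iff, star_smul, hs, smul_mul_smul_comm, smul_mul_smul_comm, hm, mul_comm c, hcc]
  simp

theorem CH_of_dSum {n : ℕ} (k : ℕ) : ∀ U₁ U₂ : QMat n, U₁ ∈ unitary (QMat n) →
    U₂ ∈ unitary (QMat n) → dSum U₁ U₂ ∈ CH (n + 1) k → U₁ ∈ CH n k ∧ U₂ ∈ CH n k := by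
  induction k with
  | zero => intro U₁ U₂ _ _ h; exact h.elim
  | succ k ih =>
    intro U₁ U₂ h₁ h₂ h
    cases k with
    | zero =>
      obtain ⟨c, hc, σ, hσ, h⟩ := h
      have e : ∀ a b f g, dSum U₁ U₂ (Fin.cons a f) (Fin.cons b g)
          = c * (σ 0 a b * tensorStr (Fin.tail σ) f g) := by
        intro a b f g
        rw [h, Matrix.smul_apply, tensorStr_cons, smul_eq_mul]
      have h0 := hσ 0
      simp only [pauliSet, Set.mem_insert_iff, Set.mem_singleton_iff] at h0
      constructor
      · refine pauli_of_unitary h₁ hc (d := σ 0 0 0) ?_ (Fin.tail σ) (fun i => hσ i.succ) ?_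
        · rcases h0 with h0 | h0 | h0 | h0 <;> simp [h0, σX, σY, σZ]
        · intro f g
          rw [← e, dSum_cons]; simp
      · refine pauli_of_unitary h₂ hc (d := σ 0 1 1) ?_ (Fin.tail σ) (fun i => hσ i.succ) ?_
        · rcases h0 with h0 | h0 | h0 | h0 <;> simp [h0, σX, σY, σZ]
        · intro f g
          rw [← e, dSum_cons]; simp
    | succ k =>
      have key : ∀ P ∈ PauliGroup n,
          U₁ * P * star U₁ ∈ CH n (k + 1) ∧ U₂ * P * star U₂ ∈ CH n (k + 1) := by
        intro P hP
        have hPu := pauli_unitary hP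
        have hh := h.2 _ (dSum_pauli hP)
        rw [dSum_star, dSum_mul, dSum_mul] at hh
        exact ih _ _ (mul_mem (mul_mem h₁ hPu) (Unitary.star_mem h₁))
          (mul_mem (mul_mem h₂ hPu) (Unitary.star_mem h₂)) hh
      exact ⟨⟨h₁, fun P hP => (key P hP).1⟩, ⟨h₂, fun P hP => (key P hP).2⟩⟩

/-- If the block-diagonal unitary `U₁ ⊕ U₂` lies in the Clifford Hierarchy
on `N = n + 1` qubits (in `CH k` for some finite `k ≥ 1`), then both `U₁` and `U₂` lie in
the Clifford Hierarchy on `n` qubits. -/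
theorem stmt2 (n : ℕ) (U₁ U₂ : QMat n)
    (h₁ : U₁ ∈ unitary (QMat n)) (h₂ : U₂ ∈ unitary (QMat n))
    (h : ∃ k, 1 ≤ k ∧ dSum U₁ U₂ ∈ CH (n + 1) k) :
    (∃ j, 1 ≤ j ∧ U₁ ∈ CH n j) ∧ (∃ j, 1 ≤ j ∧ U₂ ∈ CH n j) := by
  obtain ⟨k, hk, h⟩ := h
  have := CH_of_dSum k U₁ U₂ h₁ h₂ h
  exact ⟨⟨k, hk, this.1⟩, ⟨k, hk, this.2⟩⟩
end
end

section
/- Let U be a 2^(N-1) × 2^(N-1) unitary matrix. If the controlled gate C(U) = I ⊕ U lies in the Clifford Hierarchy on N qubits (in CH_k for some finite k ≥ 1), then there exists an integer m > 0 and a unit complex number c such that U^(2^m) = c · I (i.e., U has order 2^m up to a global phase) and U^(2^(m-1)) is an element of the (N-1)-qubit Pauli group P_{N-1}. -/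
open Matrix

noncomputable section

/-- Mixed product rule for `kron`. -/
lemma kron_mul_kron {n : ℕ} (M N : Matrix (Fin 2) (Fin 2) ℂ) (A B : QMat n) :
    kron M A * kron N B = kron (M * N) (A * B) := by
  ext f g
  simp only [Matrix.mul_apply, kron]
  rw [← (Fin.consEquiv (fun _ : Fin (n + 1) => Fin 2)).sum_comp, Fintype.sum_prod_type,
    Finset.sum_mul_sum]
  refine Finset.sum_congr rfl fun a _ => Finset.sum_congr rfl fun b _ => ?_
  simp [Fin.consEquiv]
  ring

lemma kron_one_one {n : ℕ} : kron (1 : Matrix (Fin 2) (Fin 2) ℂ) (1 : QMat n) = 1 := by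
  ext f g
  simp only [kron, Matrix.one_apply]
  by_cases h : f = g
  · subst h; simp
  · rw [if_neg h]
    by_cases h0 : f 0 = g 0
    · have : (fun i : Fin n => f i.succ) ≠ fun i => g i.succ := by
        intro h1
        apply h
        funext i
        refine Fin.cases h0 (fun j => congrFun h1 j) i
      simp [this]
    · simp [h0]

lemma tensorStr_succ {n : ℕ} (σ : Fin (n + 1) → Matrix (Fin 2) (Fin 2) ℂ) :
    tensorStr σ = kron (σ 0) (tensorStr fun i => σ i.succ) := by
  ext f g
  simp [tensorStr, kron, Fin.prod_univ_succ]

lemma pauliSet_sq {s : Matrix (Fin 2) (Fin 2) ℂ} (hs : s ∈ pauliSet) : s * s = 1 := by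
  rcases hs with rfl | rfl | rfl | rfl
  · simp
  all_goals
    ext i j
    fin_cases i <;> fin_cases j <;> simp [σX, σY, σZ]

lemma tensorStr_sq : ∀ {n : ℕ} (σ : Fin n → Matrix (Fin 2) (Fin 2) ℂ)
    (_ : ∀ i, σ i ∈ pauliSet), tensorStr σ * tensorStr σ = 1 := by
  intro n
  induction n with
  | zero =>
    intro σ _
    ext f g
    have hfg : f = g := Subsingleton.elim _ _
    subst hfg
    simp [Matrix.mul_apply, tensorStr]
  | succ n ih =>
    intro σ hσ
    rw [tensorStr_succ, kron_mul_kron, pauliSet_sq (hσ 0), ih _ (fun i => hσ i.succ),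
      kron_one_one]

lemma pauli_smul {n : ℕ} {c : ℂ} (hc : c ∈ ({1, -1, Complex.I, -Complex.I} : Set ℂ))
    {T : QMat n} (hT : T ∈ PauliGroup n) : c • T ∈ PauliGroup n := by
  obtain ⟨d, hd, σ, hσ, rfl⟩ := hT
  refine ⟨c * d, ?_, σ, hσ, by rw [smul_smul]⟩
  rcases hc with rfl | rfl | rfl | rfl <;> rcases hd with rfl | rfl | rfl | rfl <;> simp

lemma kron_smul_right {n : ℕ} (M : Matrix (Fin 2) (Fin 2) ℂ) (c : ℂ) (A : QMat n) :
    kron M (c • A) = c • kron M A := by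
  ext f g
  simp [kron]
  ring

lemma kron_smul_left {n : ℕ} (M : Matrix (Fin 2) (Fin 2) ℂ) (c : ℂ) (A : QMat n) :
    kron (c • M) A = c • kron M A := by
  ext f g
  simp [kron]
  ring

lemma pauli_succ_iff {n : ℕ} {P : QMat (n + 1)} : P ∈ PauliGroup (n + 1) ↔
    ∃ s ∈ pauliSet, ∃ T ∈ PauliGroup n, P = kron s T := by
  constructor
  · rintro ⟨c, hc, σ, hσ, rfl⟩
    refine ⟨σ 0, hσ 0, c • tensorStr fun i => σ i.succ,
      ⟨c, hc, _, fun i => hσ i.succ, rfl⟩, ?_⟩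
    rw [tensorStr_succ, kron_smul_right]
  · rintro ⟨s, hs, T, ⟨c, hc, σ, hσ, rfl⟩, rfl⟩
    refine ⟨c, hc, Fin.cons s σ, ?_, ?_⟩
    · intro i
      refine Fin.cases ?_ (fun j => ?_) i
      · simpa using hs
      · simpa using hσ j
    · rw [tensorStr_succ, kron_smul_right]
      simp

lemma one_mem_pauli (n : ℕ) : (1 : QMat n) ∈ PauliGroup n := by
  induction n with
  | zero =>
    refine ⟨1, by simp, fun _ => 1, fun i => i.elim0, ?_⟩
    ext f g
    have hfg : f = g := Subsingleton.elim _ _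
    subst hfg
    simp [tensorStr]
  | succ n ih => exact pauli_succ_iff.2 ⟨1, by simp [pauliSet], 1, ih, kron_one_one.symm⟩

/-- `X` on the first qubit. -/
def X0 (n : ℕ) : QMat (n + 1) := kron σX 1

lemma X0_mem (n : ℕ) : X0 n ∈ PauliGroup (n + 1) :=
  pauli_succ_iff.2 ⟨σX, by simp [pauliSet], 1, one_mem_pauli n, rfl⟩

lemma X0_sq (n : ℕ) : X0 n * X0 n = 1 := by
  rw [X0, kron_mul_kron, pauliSet_sq (by simp [pauliSet]), one_mul, kron_one_one]

lemma star_kron {n : ℕ} (M : Matrix (Fin 2) (Fin 2) ℂ) (A : QMat n) :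
    star (kron M A) = kron (star M) (star A) := by
  ext f g
  simp [kron, Matrix.star_apply]

lemma star_X0 (n : ℕ) : star (X0 n) = X0 n := by
  rw [X0, star_kron, star_one]
  congr 1
  ext i j
  fin_cases i <;> fin_cases j <;> simp [σX, Matrix.star_apply]

lemma X0_unitary (n : ℕ) : X0 n ∈ unitary (QMat (n + 1)) := by
  rw [Unitary.mem_iff, star_X0]
  exact ⟨X0_sq n, X0_sq n⟩

lemma σX_right {s : Matrix (Fin 2) (Fin 2) ℂ} (hs : s ∈ pauliSet) :
    ∃ c ∈ ({1, -1, Complex.I, -Complex.I} : Set ℂ), ∃ t ∈ pauliSet, s * σX = c • t := by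
  rcases hs with rfl | rfl | rfl | rfl
  · exact ⟨1, by simp, σX, by simp [pauliSet], by simp⟩
  · exact ⟨1, by simp, 1, by simp [pauliSet], by
      rw [pauliSet_sq (by simp [pauliSet]), one_smul]⟩
  · refine ⟨-Complex.I, by simp, σZ, by simp [pauliSet], ?_⟩
    ext i j
    fin_cases i <;> fin_cases j <;> simp [σX, σY, σZ]
  · refine ⟨Complex.I, by simp, σY, by simp [pauliSet], ?_⟩
    ext i j
    fin_cases i <;> fin_cases j <;> simp [σX, σY, σZ]

lemma σX_conj {s : Matrix (Fin 2) (Fin 2) ℂ} (hs : s ∈ pauliSet) :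
    ∃ c ∈ ({1, -1, Complex.I, -Complex.I} : Set ℂ), σX * s * σX = c • s := by
  rcases hs with rfl | rfl | rfl | rfl
  · exact ⟨1, by simp, by rw [mul_one, pauliSet_sq (by simp [pauliSet]), one_smul]⟩
  · exact ⟨1, by simp, by rw [pauliSet_sq (by simp [pauliSet]), one_mul, one_smul]⟩
  · refine ⟨-1, by simp, ?_⟩
    ext i j
    fin_cases i <;> fin_cases j <;> simp [σX, σY]
  · refine ⟨-1, by simp, ?_⟩
    ext i j
    fin_cases i <;> fin_cases j <;> simp [σX, σZ]

lemma pauli_mul_X0 {n : ℕ} {P : QMat (n + 1)} (hP : P ∈ PauliGroup (n + 1)) :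
    P * X0 n ∈ PauliGroup (n + 1) := by
  obtain ⟨s, hs, T, hT, rfl⟩ := pauli_succ_iff.1 hP
  obtain ⟨c, hc, t, ht, h⟩ := σX_right hs
  rw [X0, kron_mul_kron, mul_one, h, kron_smul_left]
  exact pauli_smul hc (pauli_succ_iff.2 ⟨t, ht, T, hT, rfl⟩)

lemma pauli_conj_X0 {n : ℕ} {P : QMat (n + 1)} (hP : P ∈ PauliGroup (n + 1)) :
    X0 n * P * X0 n ∈ PauliGroup (n + 1) := by
  obtain ⟨s, hs, T, hT, rfl⟩ := pauli_succ_iff.1 hP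
  obtain ⟨c, hc, h⟩ := σX_conj hs
  rw [X0, kron_mul_kron, kron_mul_kron, mul_one, one_mul, h, kron_smul_left]
  exact pauli_smul hc hP

/-- Each level of the hierarchy is stable under right multiplication by `X` on qubit `0`. -/
lemma CH_mul_X0 {n : ℕ} : ∀ {k : ℕ} {V : QMat (n + 1)}, V ∈ CH (n + 1) k →
    V * X0 n ∈ CH (n + 1) k
  | 0, _, h => h.elim
  | 1, _, h => pauli_mul_X0 h
  | (k + 2), V, h => by
    refine ⟨mul_mem h.1 (X0_unitary n), fun P hP => ?_⟩
    have := h.2 _ (pauli_conj_X0 hP)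
    rw [star_mul, star_X0]
    simpa only [mul_assoc] using this

lemma kron_add_right {n : ℕ} (M : Matrix (Fin 2) (Fin 2) ℂ) (A B : QMat n) :
    kron M (A + B) = kron M A + kron M B := by
  ext f g
  simp [kron, mul_add]

lemma dSum_apply {n : ℕ} (A B : QMat n) (f g : Fin (n + 1) → Fin 2) :
    dSum A B f g = if f 0 = g 0 then (if f 0 = 0 then A (fun i => f i.succ) (fun i => g i.succ)
      else B (fun i => f i.succ) (fun i => g i.succ)) else 0 := by
  simp only [dSum, Matrix.add_apply, kron]
  generalize f 0 = a
  generalize g 0 = b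
  fin_cases a <;> fin_cases b <;> simp

lemma zero_kron {n : ℕ} (A : QMat n) : kron 0 A = 0 := by
  ext f g
  simp [kron]

lemma dSum_conj {n : ℕ} (A B : QMat n) :
    dSum A B * X0 n * star (dSum A B) * X0 n = dSum (A * star B) (B * star A) := by
  have e1 : (!![1, 0; 0, 0] : Matrix (Fin 2) (Fin 2) ℂ) * σX * star !![1, 0; 0, 0] * σX = 0 := by
    ext i j
    fin_cases i <;> fin_cases j <;> simp [σX, Matrix.mul_apply, Matrix.vecMul, dotProduct, Matrix.star_apply]
  have e2 : (!![1, 0; 0, 0] : Matrix (Fin 2) (Fin 2) ℂ) * σX * star !![0, 0; 0, 1] * σX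
      = !![1, 0; 0, 0] := by
    ext i j
    fin_cases i <;> fin_cases j <;> simp [σX, Matrix.mul_apply, Matrix.vecMul, dotProduct, Matrix.star_apply]
  have e3 : (!![0, 0; 0, 1] : Matrix (Fin 2) (Fin 2) ℂ) * σX * star !![1, 0; 0, 0] * σX
      = !![0, 0; 0, 1] := by
    ext i j
    fin_cases i <;> fin_cases j <;> simp [σX, Matrix.mul_apply, Matrix.vecMul, dotProduct, Matrix.star_apply]
  have e4 : (!![0, 0; 0, 1] : Matrix (Fin 2) (Fin 2) ℂ) * σX * star !![0, 0; 0, 1] * σX = 0 := by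
    ext i j
    fin_cases i <;> fin_cases j <;> simp [σX, Matrix.mul_apply, Matrix.vecMul, dotProduct, Matrix.star_apply]
  simp only [dSum, X0, star_add, star_kron, add_mul, mul_add, kron_mul_kron, mul_one, e1, e2, e3,
    e4, zero_kron]
  abel

lemma CH_step {n k : ℕ} {A B : QMat n} (h : dSum A B ∈ CH (n + 1) (k + 2)) :
    dSum (A * star B) (B * star A) ∈ CH (n + 1) (k + 1) := by
  rw [← dSum_conj]
  exact CH_mul_X0 (h.2 _ (X0_mem n))

lemma pauli_of_dSum {n : ℕ} {A B : QMat n} (hB : B ∈ unitary (QMat n))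
    (h : dSum A B ∈ PauliGroup (n + 1)) : B ∈ PauliGroup n := by
  obtain ⟨s, hs, T, hT, h⟩ := pauli_succ_iff.1 h
  have key : B = s 1 1 • T := by
    ext f g
    have := congrFun (congrFun h (Fin.cons 1 f)) (Fin.cons 1 g)
    rw [dSum_apply] at this
    simpa [kron] using this
  have hB0 : B ≠ 0 := by
    rintro rfl
    have := (Unitary.mem_iff.1 hB).1
    simp at this
  rcases hs with rfl | rfl | rfl | rfl
  · rw [key]; exact pauli_smul (by simp) hT
  · exact (hB0 (by rw [key]; simp [σX])).elim
  · exact (hB0 (by rw [key]; simp [σY])).elim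
  · rw [key]; exact pauli_smul (by simp [σZ]) hT

lemma pow_mem_pauli {n : ℕ} : ∀ (k : ℕ) (W : QMat n), W ∈ unitary (QMat n) →
    dSum (star W) W ∈ CH (n + 1) (k + 1) → W ^ 2 ^ k ∈ PauliGroup n
  | 0, W, hW, h => by simpa using pauli_of_dSum hW h
  | (k + 1), W, hW, h => by
    have h1 := CH_step h
    rw [star_star, ← star_mul] at h1
    have := pow_mem_pauli k (W * W) (mul_mem hW hW) h1
    rwa [← pow_two, ← pow_mul, ← pow_succ'] at this

lemma pauli_sq {n : ℕ} {P : QMat n} (hP : P ∈ PauliGroup n) :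
    ∃ c : ℂ, ‖c‖ = 1 ∧ P ^ 2 = c • (1 : QMat n) := by
  obtain ⟨c, hc, σ, hσ, rfl⟩ := hP
  refine ⟨c ^ 2, ?_, ?_⟩
  · rcases hc with rfl | rfl | rfl | rfl <;> simp
  · rw [smul_pow, pow_two (tensorStr σ), tensorStr_sq σ hσ]

/-- If the controlled gate `C(U) = I ⊕ U` lies in the Clifford Hierarchy
on `N = n + 1` qubits, then there are an integer `m > 0` and a unit complex number `c`
with `U^(2^m) = c • I` and `U^(2^(m-1)) ∈ P_{N-1}`. -/
theorem stmt7 (n : ℕ) (U : QMat n) (hU : U ∈ unitary (QMat n))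
    (h : ∃ k, 1 ≤ k ∧ dSum 1 U ∈ CH (n + 1) k) :
    ∃ m : ℕ, 0 < m ∧ ∃ c : ℂ, ‖c‖ = 1 ∧
      U ^ 2 ^ m = c • (1 : QMat n) ∧ U ^ 2 ^ (m - 1) ∈ PauliGroup n := by
  have main : ∃ m : ℕ, U ^ 2 ^ m ∈ PauliGroup n := by
    obtain ⟨k, hk, h⟩ := h
    match k, hk, h with
    | 1, _, h => exact ⟨0, by simpa using pauli_of_dSum hU h⟩
    | (k + 2), _, h =>
      have h1 := CH_step h
      rw [one_mul, star_one, mul_one] at h1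
      exact ⟨k, pow_mem_pauli k U hU h1⟩
  obtain ⟨m, hm⟩ := main
  obtain ⟨c, hc, h2⟩ := pauli_sq hm
  refine ⟨m + 1, Nat.succ_pos m, c, hc, ?_, ?_⟩
  · rw [pow_succ, pow_mul, h2]
  · simpa using hm
end
end

section
/- No controlled odd-order Clifford gate lies in the Clifford Hierarchy: for all σ₁ ∈ {I, X, Y, Z} and σ₂, σ₃ ∈ {X, Y, Z} with σ₂ ≠ σ₃, letting V = σ₁ · exp(i(π/4)σ₂) · exp(i(π/4)σ₃) (a 2 × 2 unitary that is not a scalar multiple of the identity), the controlled gate C(V) = I ⊕ V does not lie in CH_k on 2 qubits for any finite k ≥ 1. -/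
open Matrix

noncomputable section

/-- `exp(i (π/4) σ) = cos(π/4) • I + (i sin(π/4)) • σ`. -/
def pexp (σ : Matrix (Fin 2) (Fin 2) ℂ) : Matrix (Fin 2) (Fin 2) ℂ :=
  (Real.cos (Real.pi / 4) : ℂ) • 1 + (Complex.I * (Real.sin (Real.pi / 4) : ℂ)) • σ


/-- Reindex a `2 × 2` matrix as an operator on one qubit. -/
def toQ1 (M : Matrix (Fin 2) (Fin 2) ℂ) : QMat 1 := fun f g => M (f 0) (g 0)


/-- Non-scalar matrices whose cube is a nonzero scalar. -/
def Good (W : QMat 1) : Prop := (∀ c : ℂ, W ≠ c • 1) ∧ ∃ c : ℂ, c ≠ 0 ∧ W * W * W = c • 1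

lemma Good.sq {W : QMat 1} (h : Good W) : Good (W * W) := by
  obtain ⟨h1, c, hc, h2⟩ := h
  refine ⟨?_, c * c, mul_ne_zero hc hc, ?_⟩
  · intro d hd
    rw [hd, smul_mul_assoc, one_mul] at h2
    have hd0 : d ≠ 0 := by
      rintro rfl
      have := congrFun (congrFun h2 0) 0
      simp at this
      exact hc this.symm
    apply h1 (d⁻¹ * c)
    rw [mul_smul, ← h2, smul_smul, inv_mul_cancel₀ hd0, one_smul]
  · calc W * W * (W * W) * (W * W) = (W * W * W) * (W * W * W) := by simp only [mul_assoc]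
      _ = _ := by rw [h2, smul_mul_assoc, one_mul, smul_smul]

lemma toQ1_mul (M N : Matrix (Fin 2) (Fin 2) ℂ) : toQ1 M * toQ1 N = toQ1 (M * N) := by
  ext f g
  simp only [toQ1, Matrix.mul_apply]
  exact Fintype.sum_equiv (Equiv.funUnique (Fin 1) (Fin 2)) _ _ (fun x => rfl)

lemma toQ1_one : toQ1 1 = 1 := by
  ext f g
  simp only [toQ1, Matrix.one_apply]
  congr 1
  simp [funext_iff]

lemma toQ1_smul (c : ℂ) (M : Matrix (Fin 2) (Fin 2) ℂ) : toQ1 (c • M) = c • toQ1 M := rfl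

lemma pauli_sq_s14 {σ : Matrix (Fin 2) (Fin 2) ℂ} (h : σ ∈ pauliSet) : σ * σ = 1 := by
  simp only [pauliSet, Set.mem_insert_iff, Set.mem_singleton_iff] at h
  rcases h with rfl | rfl | rfl | rfl <;> ext i j <;> fin_cases i <;> fin_cases j <;>
    simp [σX, σY, σZ]

lemma Good.ne_pauli {W : QMat 1} (h : Good W) {σ : Matrix (Fin 2) (Fin 2) ℂ}
    (hσ : σ ∈ pauliSet) (d : ℂ) : W ≠ d • toQ1 σ := by
  intro hW
  obtain ⟨h1, -⟩ := h.sq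
  apply h1 (d * d)
  rw [hW, smul_mul_smul_comm, toQ1_mul, pauli_sq_s14 hσ, toQ1_one]

lemma not_pauli {W : QMat 1} (h : Good W) {U : QMat 2} (a : Fin 2)
    (hU : ∀ f g, U (Fin.cons 1 f) (Fin.cons a g) = W f g) : U ∉ PauliGroup 2 := by
  rintro ⟨c, -, σ, hσ, rfl⟩
  refine h.ne_pauli (hσ 1) (c * σ 0 1 a) ?_
  ext f g
  rw [← hU]
  simp [tensorStr, toQ1, Fin.prod_univ_two, mul_assoc]

lemma kron_mul (M N : Matrix (Fin 2) (Fin 2) ℂ) (A B : QMat 1) :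
    kron M A * kron N B = kron (M * N) (A * B) := by
  ext f g
  simp only [kron, Matrix.mul_apply]
  rw [Finset.sum_mul_sum, ← Finset.sum_product', Finset.univ_product_univ]
  refine Fintype.sum_equiv (Fin.consEquiv (fun _ : Fin 2 => Fin 2)).symm _ _ (fun x => ?_)
  simp [Fin.consEquiv]
  unfold Fin.tail
  ring

lemma kron_star (M : Matrix (Fin 2) (Fin 2) ℂ) (A : QMat 1) :
    star (kron M A) = kron (star M) (star A) := by
  ext f g
  simp [kron, Matrix.star_apply, mul_comm]

lemma kron_zero (A : QMat 1) : kron 0 A = 0 := by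
  ext f g
  simp [kron]

/-- The block anti-diagonal matrix. -/
def aDiag (A B : QMat 1) : QMat 2 := kron !![0, 1; 0, 0] A + kron !![0, 0; 1, 0] B

lemma X_mem : kron σX (1 : QMat 1) ∈ PauliGroup 2 := by
  refine ⟨1, by simp, ![σX, 1], ?_, ?_⟩
  · intro i
    fin_cases i <;> simp [pauliSet]
  · ext f g
    rw [← toQ1_one]
    simp [kron, tensorStr, toQ1, Fin.prod_univ_two]
    exact Or.inl rfl

lemma star_00 : star (!![1, 0; 0, 0] : Matrix (Fin 2) (Fin 2) ℂ) = !![1, 0; 0, 0] := by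
  ext i j; fin_cases i <;> fin_cases j <;> simp [Matrix.star_apply]
lemma star_11 : star (!![0, 0; 0, 1] : Matrix (Fin 2) (Fin 2) ℂ) = !![0, 0; 0, 1] := by
  ext i j; fin_cases i <;> fin_cases j <;> simp [Matrix.star_apply]
lemma star_01 : star (!![0, 1; 0, 0] : Matrix (Fin 2) (Fin 2) ℂ) = !![0, 0; 1, 0] := by
  ext i j; fin_cases i <;> fin_cases j <;> simp [Matrix.star_apply]
lemma star_10 : star (!![0, 0; 1, 0] : Matrix (Fin 2) (Fin 2) ℂ) = !![0, 1; 0, 0] := by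
  ext i j; fin_cases i <;> fin_cases j <;> simp [Matrix.star_apply]
lemma zero22 : (!![0, 0; 0, 0] : Matrix (Fin 2) (Fin 2) ℂ) = 0 := by
  ext i j; fin_cases i <;> fin_cases j <;> rfl

lemma conj_dSum (A B : QMat 1) :
    dSum A B * kron σX 1 * star (dSum A B) = aDiag (A * star B) (B * star A) := by
  simp only [dSum, aDiag, star_add, kron_star, add_mul, mul_add, kron_mul, σX, star_00, star_11]
  simp only [Matrix.mul_fin_two, mul_zero, zero_mul, mul_one, one_mul, add_zero, zero_add, zero22,
    kron_zero]
  try exact add_comm _ _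

lemma conj_aDiag (A B : QMat 1) :
    aDiag A B * kron σX 1 * star (aDiag A B) = aDiag (A * star B) (B * star A) := by
  simp only [aDiag, star_add, kron_star, add_mul, mul_add, kron_mul, σX, star_01, star_10]
  simp only [Matrix.mul_fin_two, mul_zero, zero_mul, mul_one, one_mul, add_zero, zero_add, zero22,
    kron_zero]
  try exact add_comm _ _

lemma aDiag_not_mem (k : ℕ) : ∀ W : QMat 1, Good W → aDiag (star W) W ∉ CH 2 (k + 1) := by
  induction k with
  | zero =>
    intro W hW
    refine not_pauli hW 0 ?_
    intro f g
    simp [aDiag, kron]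
  | succ k ih =>
    rintro W hW ⟨-, h⟩
    have := h _ X_mem
    rw [conj_aDiag, star_star, ← star_mul] at this
    exact ih _ hW.sq this

lemma dSum_not_mem {W : QMat 1} (hW : Good W) : ∀ k, dSum 1 W ∉ CH 2 k
  | 0 => fun h => h
  | 1 => by
    refine not_pauli hW 1 ?_
    intro f g
    simp [dSum, kron]
  | k + 2 => by
    rintro ⟨-, h⟩
    have := h _ X_mem
    rw [conj_dSum, star_one, one_mul, mul_one] at this
    exact aDiag_not_mem k W hW this

lemma good_of {M : Matrix (Fin 2) (Fin 2) ℂ} {s : ℂ} (hs : s * s = 1 / 2)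
    (h01 : M 0 1 ≠ 0) {c : ℂ} (hc : c ≠ 0) (h : M * M * M = c • 1) :
    Good (toQ1 ((s * s) • M)) := by
  rw [hs]
  refine ⟨?_, (1 / 2) ^ 3 * c, by simp [hc], ?_⟩
  · intro d hd
    have := congrFun (congrFun hd (fun _ => 0)) (fun _ => 1)
    rw [← toQ1_one] at this
    simp [toQ1] at this
    exact h01 this
  · rw [toQ1_mul, toQ1_mul, ← toQ1_one, ← toQ1_smul, smul_mul_smul_comm, smul_mul_smul_comm, h,
      smul_smul]
    norm_num

lemma V_eq (σ₁ σ₂ σ₃ : Matrix (Fin 2) (Fin 2) ℂ) : σ₁ * pexp σ₂ * pexp σ₃ =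
    (((√2 / 2 : ℝ) : ℂ) * ((√2 / 2 : ℝ) : ℂ)) •
      (σ₁ * (1 + Complex.I • σ₂) * (1 + Complex.I • σ₃)) := by
  have this : ∀ σ, pexp σ = ((√2 / 2 : ℝ) : ℂ) • (1 + Complex.I • σ) := by
    intro σ
    rw [pexp, Real.cos_pi_div_four, Real.sin_pi_div_four, smul_add, smul_smul, mul_comm Complex.I]
  rw [this, this, mul_smul_comm, mul_smul_comm, smul_mul_assoc, smul_smul]

lemma V_cube (σ₁ σ₂ σ₃ : Matrix (Fin 2) (Fin 2) ℂ)
    (h₁ : σ₁ ∈ ({1, σX, σY, σZ} : Set (Matrix (Fin 2) (Fin 2) ℂ)))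
    (h₂ : σ₂ ∈ ({σX, σY, σZ} : Set (Matrix (Fin 2) (Fin 2) ℂ)))
    (h₃ : σ₃ ∈ ({σX, σY, σZ} : Set (Matrix (Fin 2) (Fin 2) ℂ)))
    (hne : σ₂ ≠ σ₃) (M : Matrix (Fin 2) (Fin 2) ℂ)
    (hM : M = σ₁ * (1 + Complex.I • σ₂) * (1 + Complex.I • σ₃)) :
    M 0 1 ≠ 0 ∧ ∃ c : ℂ, c ≠ 0 ∧ M * M * M = c • 1 := by
  have key : ∀ a b c d : ℂ, M = !![a, b; c, d] → b ≠ 0 →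
      (a + d) ^ 2 = a * d - b * c → a + d ≠ 0 → a * d - b * c ≠ 0 →
      M 0 1 ≠ 0 ∧ ∃ c : ℂ, c ≠ 0 ∧ M * M * M = c • 1 := by
    rintro a b c d rfl hb h ht hd
    refine ⟨by simpa using hb, -((a + d) * (a * d - b * c)), by simp [ht, hd], ?_⟩
    ext i j
    fin_cases i <;> fin_cases j <;> simp [Matrix.mul_apply, Fin.sum_univ_two]
    · linear_combination a * h
    · linear_combination b * h
    · linear_combination c * h
    · linear_combination d * h
  have e : M = !![M 0 0, M 0 1; M 1 0, M 1 1] := by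
    ext i j; fin_cases i <;> fin_cases j <;> rfl
  simp only [Set.mem_insert_iff, Set.mem_singleton_iff] at h₁ h₂ h₃
  rcases h₁ with rfl | rfl | rfl | rfl <;> rcases h₂ with rfl | rfl | rfl <;>
    rcases h₃ with rfl | rfl | rfl <;> first | exact absurd rfl hne | skip
  all_goals
    refine key _ _ _ _ e ?_ ?_ ?_ ?_ <;> rw [hM] <;>
      simp only [σX, σY, σZ, Matrix.one_fin_two, Matrix.smul_of, Matrix.smul_cons, Matrix.smul_empty,
        smul_eq_mul, Matrix.of_add_of, Matrix.add_cons, Matrix.cons_add_cons, Matrix.empty_add_empty,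
        Matrix.mul_fin_two] <;>
      simp [Complex.ext_iff, pow_two] <;> norm_num

/-- No controlled odd-order Clifford gate lies in the Clifford Hierarchy:
for `V = σ₁ · exp(i(π/4)σ₂) · exp(i(π/4)σ₃)` with `σ₁ ∈ {I, X, Y, Z}`,
`σ₂, σ₃ ∈ {X, Y, Z}`, `σ₂ ≠ σ₃`, the controlled gate `C(V) = I ⊕ V` is not in `CH_k`
on 2 qubits for any finite `k ≥ 1`. -/
theorem stmt14 (σ₁ σ₂ σ₃ : Matrix (Fin 2) (Fin 2) ℂ)
    (h₁ : σ₁ ∈ ({1, σX, σY, σZ} : Set (Matrix (Fin 2) (Fin 2) ℂ)))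
    (h₂ : σ₂ ∈ ({σX, σY, σZ} : Set (Matrix (Fin 2) (Fin 2) ℂ)))
    (h₃ : σ₃ ∈ ({σX, σY, σZ} : Set (Matrix (Fin 2) (Fin 2) ℂ)))
    (hne : σ₂ ≠ σ₃) :
    ¬ ∃ k, 1 ≤ k ∧ dSum (1 : QMat 1) (toQ1 (σ₁ * pexp σ₂ * pexp σ₃)) ∈ CH 2 k := by
  rintro ⟨k, -, hk⟩
  obtain ⟨h01, c, hc, h⟩ := V_cube σ₁ σ₂ σ₃ h₁ h₂ h₃ hne _ rfl
  refine dSum_not_mem ?_ k hk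
  rw [V_eq]
  refine good_of ?_ h01 hc h
  rw [← Complex.ofReal_mul]
  have : (√2 / 2 * (√2 / 2) : ℝ) = 1 / 2 := by
    nlinarith [Real.mul_self_sqrt (show (0 : ℝ) ≤ 2 by norm_num)]
  rw [this]
  norm_num
end
end

section
/- Each additional control raises a Hadamard-like gate one level in the Clifford Hierarchy: for all σ₁, σ₂ ∈ {X, Y, Z} with σ₁ ≠ σ₂, letting V = σ₁ · exp(i(π/4)σ₂), for every integer c ≥ 1 the c-times-controlled gate Cᶜ(V) — the 2^(c+1) × 2^(c+1) unitary which acts as the identity on all standard basis states except on the last two basis states (those with all c control qubits equal to |1⟩), where it acts as V — lies in CH_{c+2} on c+1 qubits. -/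
open Matrix

noncomputable section

/-- The `c`-times-controlled gate `Cᶜ(V)`: the `2^(c+1) × 2^(c+1)` matrix acting as the
identity on all standard basis states except the last two (those with all `c` control
qubits equal to `|1⟩`), where it acts as `V`; i.e. `diag(I_{2^(c+1)-2}, V)`. -/
def mctrl (c : ℕ) (V : Matrix (Fin 2) (Fin 2) ℂ) : QMat (c + 1) :=
  fun f g =>
    if (∀ i : Fin c, f i.castSucc = 1) ∧ (∀ i : Fin c, g i.castSucc = 1) then
      V (f (Fin.last c)) (g (Fin.last c))
    else if f = g then 1 else 0

abbrev Mat2 := Matrix (Fin 2) (Fin 2) ℂ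

abbrev BV (c : ℕ) := Fin c → Fin 2

def ini {c : ℕ} (f : Fin (c + 1) → Fin 2) : BV c := fun i => f i.castSucc

/-- Block operator: shift the control register by `a`, act by `M x` on the target. -/
def bop {c : ℕ} (a : BV c) (M : BV c → Mat2) : QMat (c + 1) :=
  fun f g => if ini f = ini g + a then M (ini f) (f (Fin.last c)) (g (Fin.last c)) else 0

def sgn (u : Fin 2) : ℂ := if u = 0 then 1 else -1

lemma sgn_zero : sgn 0 = 1 := by simp [sgn]
lemma sgn_one : sgn 1 = -1 := by simp [sgn]
lemma sgn_add (u v : Fin 2) : sgn (u + v) = sgn u * sgn v := by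
  fin_cases u <;> fin_cases v <;> simp [sgn]
lemma sgn_mul_self (u : Fin 2) : sgn u * sgn u = 1 := by
  fin_cases u <;> simp [sgn]
lemma star_sgn (u : Fin 2) : star (sgn u) = sgn u := by
  fin_cases u <;> simp [sgn]

lemma f2_add_self (u : Fin 2) : u + u = 0 := by revert u; decide
lemma f2_cases (u : Fin 2) : u = 0 ∨ u = 1 := by revert u; decide

lemma bv_add_self {c : ℕ} (a : BV c) : a + a = 0 := by
  funext i; exact f2_add_self _

lemma bv_add_add {c : ℕ} (x a : BV c) : x + a + a = x := by
  rw [add_assoc, bv_add_self, add_zero]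

lemma bv_eq_iff {c : ℕ} (x y a : BV c) : x = y + a ↔ y = x + a := by
  constructor <;> (rintro rfl; rw [bv_add_add])

lemma sum_split {c : ℕ} (F : BV c → Fin 2 → ℂ) :
    ∑ f : Fin (c + 1) → Fin 2, F (ini f) (f (Fin.last c)) = ∑ x, ∑ u, F x u := by
  rw [← (Fin.snocEquiv (fun _ : Fin (c + 1) => Fin 2)).sum_comp, Fintype.sum_prod_type,
    Finset.sum_comm]
  refine Finset.sum_congr rfl fun x _ => Finset.sum_congr rfl fun u _ => ?_
  have : ini ((Fin.snocEquiv (fun _ : Fin (c + 1) => Fin 2)) (u, x)) = x := by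
    funext i; simp [ini, Fin.snocEquiv]
  rw [this]; simp [Fin.snocEquiv]

lemma bop_mul {c : ℕ} (a b : BV c) (M N : BV c → Mat2) :
    bop a M * bop b N = bop (a + b) (fun x => M x * N (x + a)) := by
  ext f g
  rw [Matrix.mul_apply]
  have := sum_split (fun (x : BV c) u =>
    (if ini f = x + a then M (ini f) (f (Fin.last c)) u else 0) *
    (if x = ini g + b then N x u (g (Fin.last c)) else 0))
  refine Eq.trans this ?_
  rw [Finset.sum_eq_single (ini f + a)]
  · have e : (ini f + a = ini g + b) ↔ (ini f = ini g + (a + b)) := by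
      constructor
      · intro h; rw [← bv_add_add (ini f) a, h]; abel
      · intro h; rw [h, show ini g + (a+b) + a = ini g + b + a + a by abel, bv_add_add]
    by_cases h : ini f = ini g + (a + b)
    · have h' := e.2 h
      simp only [bop, bv_add_add, if_true, if_pos h, if_pos h', Matrix.mul_apply]
    · have h' := fun q => h (e.1 q)
      simp only [bop, if_neg h, if_neg h', mul_zero, Finset.sum_const_zero]
  · intro x _ hx
    have : ¬ ini f = x + a := fun q => hx ((bv_eq_iff _ _ _).1 q)
    simp [this]
  · simp

lemma bop_star {c : ℕ} (a : BV c) (M : BV c → Mat2) :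
    star (bop a M) = bop a (fun x => star (M (x + a))) := by
  ext f g
  rw [Matrix.star_apply]
  simp only [bop, bv_eq_iff (ini g)]
  by_cases h : ini f = ini g + a
  · simp only [if_pos h, Matrix.star_apply]
    rw [h, bv_add_add]
  · simp [if_neg h]

lemma bop_one {c : ℕ} : bop (0 : BV c) (fun _ => 1) = 1 := by
  ext f g
  simp only [bop, add_zero, Matrix.one_apply]
  by_cases h : f = g
  · subst h; simp
  · rw [if_neg h]
    by_cases h1 : ini f = ini g
    · rw [if_pos h1, if_neg]
      intro h2; apply h; funext i
      refine Fin.lastCases h2 (fun j => congrFun h1 j) i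
    · rw [if_neg h1]

/-- affine functions -/
def Aff {c : ℕ} (l : BV c → Fin 2) : Prop := ∀ x y, l (x + y) = l x + l y + l 0

lemma Aff.add {c : ℕ} {l m : BV c → Fin 2} (hl : Aff l) (hm : Aff m) :
    Aff (fun x => l x + m x) := by
  intro x y; simp only [hl x y, hm x y]; abel
lemma Aff.const {c : ℕ} (u : Fin 2) : Aff (fun _ : BV c => u) := by
  intro x y; simp only [f2_add_self, zero_add]
lemma Aff.shift {c : ℕ} {l : BV c → Fin 2} (hl : Aff l) (a : BV c) :
    Aff (fun x => l (x + a)) := by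
  have : (fun x => l (x + a)) = fun x => l x + (l a + l 0) := by
    funext x; rw [hl]; abel
  rw [this]; exact hl.add (Aff.const _)
lemma Aff.smul {c : ℕ} {l : BV c → Fin 2} (hl : Aff l) (e : Fin 2) :
    Aff (fun x => e * l x) := by
  rcases f2_cases e with rfl | rfl
  · simpa using Aff.const 0
  · simpa using hl

lemma Aff.formula {c : ℕ} {l : BV c → Fin 2} (hl : Aff l) :
    ∃ b : Fin c → Fin 2, ∀ x, l x = l 0 + ∑ i, b i * x i := by
  let L : BV c →+ Fin 2 :=
    { toFun := fun x => l x + l 0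
      map_zero' := f2_add_self _
      map_add' := fun x y => by rw [hl]; abel }
  refine ⟨fun i => L (Pi.single i 1), fun x => ?_⟩
  have h : L x = ∑ i, L (Pi.single i 1) * x i := by
    conv_lhs => rw [← Finset.univ_sum_single x, map_sum]
    refine Finset.sum_congr rfl fun i _ => ?_
    rcases f2_cases (x i) with h | h <;> simp [h]
  rw [← h]
  show l x = l 0 + (l x + l 0)
  rw [add_comm (l x), ← add_assoc, f2_add_self, zero_add]

/-- one-qubit Pauli group -/
def G1 (Q : Mat2) : Prop := ∃ k : ℂ, k ^ 4 = 1 ∧ ∃ s ∈ pauliSet, Q = k • s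

lemma four_iff (k : ℂ) : k ^ 4 = 1 ↔ k ∈ ({1, -1, Complex.I, -Complex.I} : Set ℂ) := by
  constructor
  · intro h
    have : (k - 1) * ((k + 1) * ((k - Complex.I) * (k + Complex.I))) = 0 := by
      have := Complex.I_sq
      linear_combination h - (k^2-1) * this
    rcases mul_eq_zero.1 this with h | h
    · left; linear_combination h
    rcases mul_eq_zero.1 h with h | h
    · right; left; linear_combination h
    rcases mul_eq_zero.1 h with h | h
    · right; right; left; linear_combination h
    · right; right; right; simp only [Set.mem_singleton_iff]; linear_combination h
  · rintro (rfl | rfl | rfl | rfl) <;> norm_num [Complex.I_pow_four]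

lemma star_four {k : ℂ} (h : k ^ 4 = 1) : k * star k = 1 := by
  rcases (four_iff k).1 h with rfl | rfl | rfl | rfl <;> simp

lemma sgn_four (u : Fin 2) : sgn u ^ 4 = 1 := by
  fin_cases u <;> norm_num [sgn]

lemma G1.smul {Q : Mat2} (h : G1 Q) {k : ℂ} (hk : k ^ 4 = 1) : G1 (k • Q) := by
  obtain ⟨j, hj, s, hs, rfl⟩ := h
  exact ⟨k * j, by rw [mul_pow, hk, hj, one_mul], s, hs, by rw [smul_smul]⟩

lemma G1.one : G1 1 := ⟨1, by simp, 1, by simp [pauliSet], by simp⟩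

lemma G1.of {s : Mat2} (h : s ∈ pauliSet) : G1 s := ⟨1, by simp, s, h, by simp⟩

lemma I_four : Complex.I ^ 4 = 1 := Complex.I_pow_four
lemma negI_four : (-Complex.I) ^ 4 = 1 := by rw [four_iff]; simp

lemma pauli_mul {s t : Mat2} (hs : s ∈ pauliSet) (ht : t ∈ pauliSet) : G1 (s * t) := by
  rcases hs with rfl | rfl | rfl | rfl
  · rw [one_mul]; exact G1.of ht
  all_goals rcases ht with rfl | rfl | rfl | rfl
  · rw [mul_one]; exact G1.of (by simp [pauliSet])
  · exact ⟨1, by simp, 1, by simp [pauliSet], by ext i j; fin_cases i <;> fin_cases j <;> simp [σX]⟩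
  · exact ⟨_, I_four, σZ, by simp [pauliSet],
      by ext i j; fin_cases i <;> fin_cases j <;> simp [σX, σY, σZ]⟩
  · exact ⟨_, negI_four, σY, by simp [pauliSet],
      by ext i j; fin_cases i <;> fin_cases j <;> simp [σX, σY, σZ]⟩
  · rw [mul_one]; exact G1.of (by simp [pauliSet])
  · exact ⟨_, negI_four, σZ, by simp [pauliSet],
      by ext i j; fin_cases i <;> fin_cases j <;> simp [σX, σY, σZ]⟩
  · exact ⟨1, by simp, 1, by simp [pauliSet], by ext i j; fin_cases i <;> fin_cases j <;> simp [σY]⟩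
  · exact ⟨_, I_four, σX, by simp [pauliSet],
      by ext i j; fin_cases i <;> fin_cases j <;> simp [σX, σY, σZ]⟩
  · rw [mul_one]; exact G1.of (by simp [pauliSet])
  · exact ⟨_, I_four, σY, by simp [pauliSet],
      by ext i j; fin_cases i <;> fin_cases j <;> simp [σX, σY, σZ]⟩
  · exact ⟨_, negI_four, σX, by simp [pauliSet],
      by ext i j; fin_cases i <;> fin_cases j <;> simp [σX, σY, σZ]⟩
  · exact ⟨1, by simp, 1, by simp [pauliSet], by ext i j; fin_cases i <;> fin_cases j <;> simp [σZ]⟩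

lemma G1.mul {Q R : Mat2} (hQ : G1 Q) (hR : G1 R) : G1 (Q * R) := by
  obtain ⟨j, hj, s, hs, rfl⟩ := hQ
  obtain ⟨k, hk, t, ht, rfl⟩ := hR
  rw [smul_mul_smul_comm]
  exact (pauli_mul hs ht).smul (by rw [mul_pow, hk, hj, one_mul])

lemma pauli_star {s : Mat2} (hs : s ∈ pauliSet) : star s = s := by
  rcases hs with rfl | rfl | rfl | rfl
  · simp
  all_goals ext i j; fin_cases i <;> fin_cases j <;> simp [σX, σY, σZ, Matrix.star_apply]

lemma pauli_sq_s16 {s : Mat2} (hs : s ∈ pauliSet) : s * s = 1 := by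
  rcases hs with rfl | rfl | rfl | rfl
  · simp
  all_goals ext i j; fin_cases i <;> fin_cases j <;> simp [σX, σY, σZ]

lemma pauli_comm {s t : Mat2} (hs : s ∈ pauliSet) (ht : t ∈ pauliSet) :
    ∃ e, s * t = sgn e • (t * s) := by
  have key : s * t = t * s ∨ s * t = - (t * s) := by
    rcases hs with rfl | rfl | rfl | rfl
    · simp
    all_goals rcases ht with rfl | rfl | rfl | rfl
    all_goals first
      | (left; simp; done)
      | (right; ext i j; fin_cases i <;> fin_cases j <;> simp [σX, σY, σZ]; done)
  rcases key with h | h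
  · exact ⟨0, by simp [sgn, h]⟩
  · exact ⟨1, by simp [sgn, h]⟩

lemma G1.star_mem {Q : Mat2} (hQ : G1 Q) : G1 (star Q) := by
  obtain ⟨j, hj, s, hs, rfl⟩ := hQ
  refine ⟨star j, ?_, s, hs, ?_⟩
  · rw [← star_pow, hj, star_one]
  · rw [star_smul, pauli_star hs]

lemma G1.mul_star {Q : Mat2} (hQ : G1 Q) : Q * star Q = 1 := by
  obtain ⟨j, hj, s, hs, rfl⟩ := hQ
  rw [star_smul, pauli_star hs, smul_mul_smul_comm, pauli_sq_s16 hs, star_four hj, one_smul]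

lemma G1.star_mul {Q : Mat2} (hQ : G1 Q) : star Q * Q = 1 := by
  have := G1.mul_star hQ.star_mem
  rwa [star_star] at this

lemma G1.star_eq {Q : Mat2} (hQ : G1 Q) : ∃ e, star Q = sgn e • Q := by
  obtain ⟨j, hj, s, hs, rfl⟩ := hQ
  rw [star_smul, pauli_star hs]
  rcases (four_iff j).1 hj with rfl | rfl | rfl | rfl
  · exact ⟨0, by simp [sgn]⟩
  · exact ⟨0, by simp [sgn]⟩
  · exact ⟨1, by simp [sgn]⟩
  · exact ⟨1, by simp [sgn]⟩

lemma G1.conj {Q E : Mat2} (hQ : G1 Q) (hE : G1 E) : ∃ e, Q * E * star Q = sgn e • E := by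
  have h : ∃ e, Q * E = sgn e • (E * Q) := by
    obtain ⟨j, hj, s, hs, rfl⟩ := hQ
    obtain ⟨k, hk, t, ht, rfl⟩ := hE
    obtain ⟨e, he⟩ := pauli_comm hs ht
    refine ⟨e, ?_⟩
    rw [smul_mul_smul_comm, smul_mul_smul_comm, he, smul_smul, smul_smul]
    congr 1; ring
  obtain ⟨e, he⟩ := h
  exact ⟨e, by rw [he, smul_mul_assoc, mul_assoc, hQ.mul_star, mul_one]⟩

/-! Pauli group in block form -/

lemma pauli_entry {s : Mat2} (hs : s ∈ pauliSet) : ∃ (a b : Fin 2) (p : ℂ), p ^ 4 = 1 ∧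
    ∀ u v, s u v = if u = v + a then p * sgn (b * u) else 0 := by
  rcases hs with rfl | rfl | rfl | rfl
  · exact ⟨0, 0, 1, by simp, fun u v => by fin_cases u <;> fin_cases v <;> simp [sgn]⟩
  · exact ⟨1, 0, 1, by simp, fun u v => by fin_cases u <;> fin_cases v <;> simp [sgn, σX]⟩
  · exact ⟨1, 1, _, negI_four, fun u v => by fin_cases u <;> fin_cases v <;> simp [sgn, σY]⟩
  · exact ⟨0, 1, 1, by simp, fun u v => by fin_cases u <;> fin_cases v <;> simp [sgn, σZ]⟩

lemma entry_pauli (a b : Fin 2) : ∃ s ∈ pauliSet, ∃ p : ℂ, p ^ 4 = 1 ∧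
    ∀ u v, s u v = if u = v + a then p * sgn (b * u) else 0 := by
  fin_cases a <;> fin_cases b
  · exact ⟨1, by simp [pauliSet], 1, by simp,
      fun u v => by fin_cases u <;> fin_cases v <;> simp [sgn]⟩
  · exact ⟨σZ, by simp [pauliSet], 1, by simp,
      fun u v => by fin_cases u <;> fin_cases v <;> simp [sgn, σZ]⟩
  · exact ⟨σX, by simp [pauliSet], 1, by simp,
      fun u v => by fin_cases u <;> fin_cases v <;> simp [sgn, σX]⟩
  · exact ⟨σY, by simp [pauliSet], _, negI_four,
      fun u v => by fin_cases u <;> fin_cases v <;> simp [sgn, σY]⟩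

lemma sgn_sum {ι : Type*} (s : Finset ι) (f : ι → Fin 2) :
    sgn (∑ i ∈ s, f i) = ∏ i ∈ s, sgn (f i) := by
  classical
  induction s using Finset.induction_on with
  | empty => simp [sgn]
  | insert i s hi ih => rw [Finset.sum_insert hi, Finset.prod_insert hi, sgn_add, ih]

lemma tensor_block {c : ℕ} (s : Fin (c + 1) → Mat2) (a b : BV c) (p : Fin c → ℂ)
    (h : ∀ i u v, s (Fin.castSucc i) u v = if u = v + a i then p i * sgn (b i * u) else 0) :
    tensorStr s = (∏ i, p i) • bop a (fun x => sgn (∑ i, b i * x i) • s (Fin.last c)) := by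
  ext f g
  simp only [tensorStr, Fin.prod_univ_castSucc, h, Matrix.smul_apply, bop, smul_eq_mul]
  by_cases hh : ini f = ini g + a
  · have h2 : ∀ i : Fin c, f i.castSucc = g i.castSucc + a i := fun i => congrFun hh i
    rw [if_pos hh]
    have : ∀ i : Fin c, (if f i.castSucc = g i.castSucc + a i then
        p i * sgn (b i * f i.castSucc) else 0) = p i * sgn (b i * f i.castSucc) :=
      fun i => if_pos (h2 i)
    simp only [this, Finset.prod_mul_distrib, sgn_sum, ini]
    ring
  · rw [if_neg hh, mul_zero]
    have : ∃ i : Fin c, ¬ (f i.castSucc = g i.castSucc + a i) := by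
      by_contra hcon; push Not at hcon
      exact hh (funext hcon)
    obtain ⟨i, hi⟩ := this
    rw [Finset.prod_eq_zero (Finset.mem_univ i) (if_neg hi), zero_mul]

lemma smul_bop {c : ℕ} (k : ℂ) (a : BV c) (M : BV c → Mat2) :
    k • bop a M = bop a (fun x => k • M x) := by
  ext f g
  simp only [bop, Matrix.smul_apply]
  split_ifs <;> simp

lemma prod_four {ι : Type*} (s : Finset ι) (p : ι → ℂ) (h : ∀ i, p i ^ 4 = 1) :
    (∏ i ∈ s, p i) ^ 4 = 1 := by
  rw [← Finset.prod_pow]; exact Finset.prod_eq_one fun i _ => h i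

lemma aff_sum {c : ℕ} (b : BV c) : Aff (fun x : BV c => ∑ i, b i * x i) := by
  intro x y
  simp only [Pi.add_apply, Pi.zero_apply, mul_zero, Finset.sum_const_zero, add_zero]
  rw [← Finset.sum_add_distrib]
  refine Finset.sum_congr rfl fun i _ => ?_
  generalize b i = u; generalize x i = v; generalize y i = w
  revert u v w; decide

lemma pauli_iff {c : ℕ} (P : QMat (c + 1)) : P ∈ PauliGroup (c + 1) ↔
    ∃ (a : BV c) (l : BV c → Fin 2) (Q : Mat2), Aff l ∧ G1 Q ∧
      P = bop a (fun x => sgn (l x) • Q) := by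
  constructor
  · rintro ⟨k, hk, s, hs, rfl⟩
    choose a b p hp h using fun i => pauli_entry (hs i)
    refine ⟨fun i => a i.castSucc, fun x => ∑ i, b i.castSucc * x i,
      (k * ∏ i : Fin c, p i.castSucc) • s (Fin.last c), aff_sum _, ?_, ?_⟩
    · refine (G1.of (hs _)).smul ?_
      rw [mul_pow, (four_iff k).2 hk, prod_four _ _ (fun i => hp _), one_mul]
    · rw [tensor_block s (fun i => a i.castSucc) (fun i => b i.castSucc)
        (fun i => p i.castSucc) (fun i => h _), smul_smul, smul_bop]
      congr 1; funext x
      rw [smul_comm]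
  · rintro ⟨a, l, Q, hl, ⟨k, hk, t, ht, rfl⟩, rfl⟩
    obtain ⟨b, hb⟩ := hl.formula
    choose s hs p hp h using fun i => entry_pauli (a i) (b i)
    have hP := prod_four Finset.univ p hp
    refine ⟨sgn (l 0) * k * star (∏ i, p i), ?_, Fin.snoc s t, ?_, ?_⟩
    · rw [← four_iff, mul_pow, mul_pow, hk, sgn_four, ← star_pow, hP]; simp
    · intro i
      refine Fin.lastCases ?_ (fun j => ?_) i
      · simpa using ht
      · simpa using hs j
    · rw [tensor_block (Fin.snoc s t) a b p (fun i u v => by simpa using h i u v), smul_smul,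
        smul_bop]
      congr 1; funext x
      rw [hb x, sgn_add, Fin.snoc_last, smul_smul, smul_smul]
      congr 1
      linear_combination (- sgn (l 0) * k * sgn (∑ i, b i * x i)) * star_four hP

lemma pg_mul {c : ℕ} {P R : QMat (c + 1)} (hP : P ∈ PauliGroup (c + 1))
    (hR : R ∈ PauliGroup (c + 1)) : P * R ∈ PauliGroup (c + 1) := by
  rw [pauli_iff] at *
  obtain ⟨a, l, Q, hl, hQ, rfl⟩ := hP
  obtain ⟨b, m, R, hm, hR, rfl⟩ := hR
  refine ⟨a + b, fun x => l x + m (x + a), Q * R, hl.add (hm.shift a), hQ.mul hR, ?_⟩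
  rw [bop_mul]
  congr 1; funext x
  rw [smul_mul_smul_comm, sgn_add]

lemma pg_star {c : ℕ} {P : QMat (c + 1)} (hP : P ∈ PauliGroup (c + 1)) :
    star P ∈ PauliGroup (c + 1) := by
  rw [pauli_iff] at *
  obtain ⟨a, l, Q, hl, hQ, rfl⟩ := hP
  refine ⟨a, fun x => l (x + a), star Q, hl.shift a, hQ.star_mem, ?_⟩
  rw [bop_star]
  congr 1; funext x
  rw [star_smul, star_sgn]

lemma pg_one {c : ℕ} : (1 : QMat (c + 1)) ∈ PauliGroup (c + 1) := by
  rw [pauli_iff]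
  exact ⟨0, fun _ => 0, 1, Aff.const 0, G1.one, by simp [sgn, bop_one]⟩

lemma bop_unitary {c : ℕ} (a : BV c) (M : BV c → Mat2) (h1 : ∀ x, M x * star (M x) = 1) :
    bop a M ∈ unitary (QMat (c + 1)) := by
  have h2 : ∀ x, star (M x) * M x = 1 := fun x => mul_eq_one_comm.1 (h1 x)
  rw [Unitary.mem_iff, bop_star, bop_mul, bop_mul, bv_add_self]
  simp only [bv_add_add, h1, h2, bop_one, and_self]

lemma pg_unitary {c : ℕ} {P : QMat (c + 1)} (hP : P ∈ PauliGroup (c + 1)) :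
    P ∈ unitary (QMat (c + 1)) := by
  rw [pauli_iff] at *
  obtain ⟨a, l, Q, hl, hQ, rfl⟩ := hP
  refine bop_unitary _ _ fun x => ?_
  rw [star_smul, star_sgn, smul_mul_smul_comm, sgn_mul_self, one_smul, hQ.mul_star]

/-- `M` (times any Pauli) is in level `k`. -/
def Lev {c : ℕ} (k : ℕ) (M : BV c → Mat2) : Prop :=
  ∀ P ∈ PauliGroup (c + 1), bop 0 M * P ∈ CH (c + 1) k

lemma lev_step {c : ℕ} (k : ℕ) (M : BV c → Mat2) (hM : ∀ x, M x * star (M x) = 1)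
    (h : ∀ (a : BV c), ∀ Q, G1 Q →
      Lev (k + 1) (fun x => M x * (Q * star (M (x + a)) * star Q))) : Lev (k + 2) M := by
  intro P hP
  refine ⟨mul_mem (bop_unitary _ _ hM) (pg_unitary hP), fun R hR => ?_⟩
  have hR' : P * R * star P ∈ PauliGroup (c + 1) := pg_mul (pg_mul hP hR) (pg_star hP)
  have e : bop 0 M * P * R * star (bop 0 M * P) = bop 0 M * (P * R * star P) * star (bop 0 M) := by
    rw [star_mul]; simp only [mul_assoc]
  rw [e]
  obtain ⟨a, l, Q, hl, hQ, hPR⟩ := (pauli_iff _).1 hR'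
  have := h a Q hQ _ hR'
  rw [hPR] at this ⊢
  convert this using 1
  rw [bop_star, bop_mul, bop_mul, bop_mul]
  simp only [zero_add, add_zero]
  congr 1; funext x
  have h3 := hQ.star_mul
  simp only [mul_smul_comm, smul_mul_assoc, mul_assoc, h3, mul_one]

/-- affine set cut out by `m` equations -/
def Cut {c m : ℕ} (h : Fin m → BV c → Fin 2) (x : BV c) : Prop := ∀ i, h i x = 1

lemma aff_inv {c : ℕ} {l : BV c → Fin 2} (hl : Aff l) (x a : BV c) :
    l (x + a) = l x + (l a + l 0) := by rw [hl]; abel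

lemma cut_split {c m : ℕ} (h : Fin (m + 1) → BV c → Fin 2) (hh : ∀ i, Aff (h i)) (a : BV c) :
    (∀ x, Cut h (x + a) ↔ Cut h x) ∨
    ∃ (h' : Fin m → BV c → Fin 2) (k : BV c → Fin 2), (∀ i, Aff (h' i)) ∧ Aff k ∧
      (∀ x, Cut h x ↔ Cut h' x ∧ k x = 1) ∧ (∀ x, Cut h' (x + a) ↔ Cut h' x) ∧
      (∀ x, k (x + a) = k x + 1) := by
  by_cases hz : ∀ i, h i a + h i 0 = 0
  · left; intro x
    simp only [Cut, aff_inv (hh _) x a, hz, add_zero]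
  · right
    push Not at hz
    obtain ⟨j, hj⟩ := hz
    have hj : h j a + h j 0 = 1 := (f2_cases _).resolve_left hj
    let d : Fin m → Fin 2 := fun i => h (j.succAbove i) a + h (j.succAbove i) 0
    refine ⟨fun i x => h (j.succAbove i) x + (d i * (h j x + 1)), h j, ?_, hh j, ?_, ?_, ?_⟩
    · exact fun i => (hh _).add (((hh j).add (Aff.const 1)).smul _)
    · intro x
      simp only [Cut, Fin.forall_iff_succAbove j]
      constructor
      · rintro ⟨h1, h2⟩
        refine ⟨fun i => ?_, h1⟩
        rw [h1, h2 i, f2_add_self, mul_zero, add_zero]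
      · rintro ⟨h1, h2⟩
        refine ⟨h2, fun i => ?_⟩
        have := h1 i
        rwa [h2, f2_add_self, mul_zero, add_zero] at this
    · intro x
      refine forall_congr' fun i => ?_
      have e : h (j.succAbove i) (x + a) + d i * (h j (x + a) + 1) =
          h (j.succAbove i) x + d i * (h j x + 1) := by
        rw [aff_inv (hh _) x a, aff_inv (hh j) x a, hj]
        change h (j.succAbove i) x + d i + _ = _
        generalize h (j.succAbove i) x = u; generalize d i = v; generalize h j x = w
        revert u v w; decide
      simp only [e]
    · intro x
      rw [aff_inv (hh j) x a, hj]

open Classical in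
lemma lev_B {c : ℕ} (m : ℕ) : ∀ (E : Mat2) (_ : G1 E)
    (h : Fin m → BV c → Fin 2) (_ : ∀ i, Aff (h i)) (l : BV c → Fin 2) (_ : Aff l),
    Lev (m + 1) (fun x => if Cut h x then sgn (l x) • E else 1) := by
  induction m with
  | zero =>
    intro E hE h hh l hl P hP
    have : ∀ x, Cut h x := fun x i => i.elim0
    simp only [this, if_true]
    exact pg_mul ((pauli_iff _).2 ⟨0, l, E, hl, hE, rfl⟩) hP
  | succ m ih =>
    intro E hE h hh l hl
    apply lev_step
    · intro x
      split_ifs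
      · rw [star_smul, star_sgn, smul_mul_smul_comm, sgn_mul_self, one_smul, hE.mul_star]
      · simp
    intro a Q hQ
    obtain ⟨e, he⟩ := hQ.conj hE.star_mem
    rcases cut_split h hh a with hinv | ⟨h', k, hh', hk, h1, h2, h3⟩
    · have := ih 1 G1.one (fun i => h i.succ) (fun i => hh _)
        (fun x => (e + (l a + l 0)) * h 0 x) ((hh 0).smul _)
      convert this using 2 with x
      simp only [hinv]
      by_cases hx : Cut h x
      · have hx' : Cut (fun i : Fin m => h i.succ) x := fun i => hx _
        rw [if_pos hx, if_pos hx, if_pos hx', hx 0, mul_one, star_smul, star_sgn, aff_inv hl]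
        simp only [mul_smul_comm, smul_mul_assoc, he, smul_smul, hE.mul_star]
        congr 1
        simp only [sgn_add]
        linear_combination (sgn e * sgn (l a) * sgn (l 0)) * sgn_mul_self (l x)
      · rw [if_neg hx, if_neg hx]
        by_cases hx' : Cut (fun i : Fin m => h i.succ) x
        · have : h 0 x = 0 := (f2_cases _).resolve_right
            fun h0 => hx ((Fin.forall_fin_succ).2 ⟨h0, hx'⟩)
          rw [if_pos hx', this, mul_zero, sgn_zero]
          simp [hQ.mul_star]
        · rw [if_neg hx']; simp [hQ.mul_star]
    · obtain ⟨r, hr⟩ := hE.star_eq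
      have := ih E hE h' hh' (fun x => l x + (e + r + (l a + l 0)) * (k x + 1))
        (hl.add ((hk.add (Aff.const 1)).smul _))
      convert this using 2 with x
      simp only [h1, h2, h3]
      by_cases hx : Cut h' x
      · rcases f2_cases (k x) with hkx | hkx
        · simp only [hx, hkx, if_true]
          simp only [zero_add, and_self, zero_ne_one, and_false, if_false, if_true, one_mul, mul_one]
          rw [star_smul, mul_smul_comm, smul_mul_assoc, he, hr, star_sgn, aff_inv hl, smul_smul,
            smul_smul]
          congr 1
          simp only [sgn_add]; ring
        · simp [hx, hkx, hQ.mul_star]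
      · simp [hx, hQ.mul_star]

/-- the Hadamard-like block -/
def had (s t : Mat2) (u v : Fin 2) : Mat2 := ((Real.sqrt 2 : ℂ)⁻¹) • (sgn u • s + sgn v • t)

lemma sqrt_two_inv : ((Real.sqrt 2 : ℂ)⁻¹) * ((Real.sqrt 2 : ℂ)⁻¹) = 1 / 2 := by
  rw [← mul_inv, ← Complex.ofReal_mul, Real.mul_self_sqrt (by norm_num)]; norm_num

lemma had_star {s t : Mat2} (hs : star s = s) (ht : star t = t) (u v : Fin 2) :
    star (had s t u v) = had s t u v := by
  simp only [had, star_smul, star_add, hs, ht, star_sgn]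
  congr 1
  simp

lemma had_mul {s t : Mat2} (hs : s * s = 1) (ht : t * t = 1) (hst : t * s = - (s * t))
    (u v d e : Fin 2) : had s t u v * had s t (u + d) (v + e) =
      if d = e then sgn d • 1 else sgn (u + v + e) • (s * t) := by
  have h : had s t u v * had s t (u + d) (v + e) =
      ((1 / 2 : ℂ) * (sgn d + sgn e)) • (1 : Mat2) +
      ((1 / 2 : ℂ) * (sgn u * sgn v * (sgn e - sgn d))) • (s * t) := by
    rw [had, had, smul_mul_smul_comm, sqrt_two_inv, mul_add, add_mul, add_mul]
    simp only [smul_mul_smul_comm, hs, ht, hst, sgn_add]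
    have := sgn_mul_self u
    have := sgn_mul_self v
    simp only [smul_neg, ← neg_smul, smul_add, smul_smul]
    rw [show ∀ A B C D : Mat2, A + B + (C + D) = (A + D) + (C + B) from fun A B C D => by abel]
    rw [← add_smul, ← add_smul]
    congr 2
    · linear_combination (1 / 2 * sgn d) * sgn_mul_self u + (1/2 * sgn e) * sgn_mul_self v
    · ring
  rw [h]
  rcases f2_cases d with rfl | rfl <;> rcases f2_cases e with rfl | rfl <;>
    simp [sgn_add, sgn_zero, sgn_one] <;> norm_num
  · congr 1; ring
  · congr 1; ring

open Classical in
lemma lev_A {c : ℕ} (s t : Mat2) (hs : G1 s) (ht : G1 t) (ss : star s = s) (st : star t = t)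
    (hst : t * s = - (s * t)) (m : ℕ) : ∀ (h : Fin m → BV c → Fin 2) (_ : ∀ i, Aff (h i))
    (p q : BV c → Fin 2) (_ : Aff p) (_ : Aff q),
    Lev (m + 2) (fun x => if Cut h x then had s t (p x) (q x) else 1) := by
  have s2 : s * s = 1 := by have := hs.mul_star; rwa [ss] at this
  have t2 : t * t = 1 := by have := ht.mul_star; rwa [st] at this
  have hcj : ∀ Q, G1 Q → ∃ d e, ∀ u v, Q * had s t u v * star Q = had s t (u + d) (v + e) := by
    intro Q hQ
    obtain ⟨d, hd⟩ := hQ.conj hs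
    obtain ⟨e, he⟩ := hQ.conj ht
    refine ⟨d, e, fun u v => ?_⟩
    simp only [had, mul_smul_comm, smul_mul_assoc, mul_add, add_mul, hd, he, sgn_add, smul_smul]
  have hun : ∀ u v, had s t u v * had s t u v = 1 := by
    intro u v
    have := had_mul s2 t2 hst u v 0 0
    simpa [sgn_zero] using this
  have inv : ∀ (m : ℕ) (h : Fin m → BV c → Fin 2) (_ : ∀ i, Aff (h i))
      (p q : BV c → Fin 2) (_ : Aff p) (_ : Aff q) (a : BV c) (Q : Mat2) (_ : G1 Q)
      (_ : ∀ x, Cut h (x + a) ↔ Cut h x), Lev (m + 1) (fun x =>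
        (if Cut h x then had s t (p x) (q x) else 1) * (Q *
          star (if Cut h (x + a) then had s t (p (x + a)) (q (x + a)) else 1) * star Q)) := by
    intro m h hh p q hp hq a Q hQ hinv
    obtain ⟨d, e, hde⟩ := hcj Q hQ
    by_cases hd : p a + p 0 + d = q a + q 0 + e
    · have := lev_B m 1 G1.one h hh (fun _ => p a + p 0 + d) (Aff.const _)
      convert this using 2 with x
      simp only [hinv]
      by_cases hx : Cut h x
      · simp only [hx, if_true, had_star ss st, hde]
        rw [aff_inv hp, aff_inv hq, add_assoc (p x), add_assoc (q x), had_mul s2 t2 hst,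
          if_pos hd]
      · simp [hx, hQ.mul_star]
    · have := lev_B m (s * t) (hs.mul ht) h hh (fun x => p x + q x + (q a + q 0 + e))
        ((hp.add hq).add (Aff.const _))
      convert this using 2 with x
      simp only [hinv]
      by_cases hx : Cut h x
      · simp only [hx, if_true, had_star ss st, hde]
        rw [aff_inv hp, aff_inv hq, add_assoc (p x), add_assoc (q x), had_mul s2 t2 hst,
          if_neg hd]
      · simp [hx, hQ.mul_star]
  induction m with
  | zero =>
    intro h hh p q hp hq
    apply lev_step
    · intro x
      split_ifs
      · rw [had_star ss st, hun]
      · simp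
    intro a Q hQ
    exact inv 0 h hh p q hp hq a Q hQ
      (fun x => ⟨fun _ i => i.elim0, fun _ i => i.elim0⟩)
  | succ m ih =>
    intro h hh p q hp hq
    apply lev_step
    · intro x
      split_ifs
      · rw [had_star ss st, hun]
      · simp
    intro a Q hQ
    rcases cut_split h hh a with hinv | ⟨h', k, hh', hk, h1, h2, h3⟩
    · exact inv (m + 1) h hh p q hp hq a Q hQ hinv
    · obtain ⟨d, e, hde⟩ := hcj Q hQ
      have := ih h' hh' (fun x => p x + (p a + p 0 + d) * (k x + 1))
        (fun x => q x + (q a + q 0 + e) * (k x + 1))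
        (hp.add ((hk.add (Aff.const 1)).smul _)) (hq.add ((hk.add (Aff.const 1)).smul _))
      convert this using 2 with x
      simp only [h1, h2, h3]
      by_cases hx : Cut h' x
      · rcases f2_cases (k x) with hkx | hkx
        · simp [hx, hkx, had_star ss st, hde, aff_inv hp, aff_inv hq, add_assoc]
        · simp [hx, hkx, hQ.mul_star]
      · simp [hx, hQ.mul_star]

lemma pexp_had (s r : Mat2) : s * pexp r = had s (Complex.I • (s * r)) 0 0 := by
  have h : (Real.sqrt 2 : ℂ) / 2 = (Real.sqrt 2 : ℂ)⁻¹ := by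
    have h0 : (Real.sqrt 2 : ℂ) ≠ 0 := by simp
    have h2 : (Real.sqrt 2 : ℂ) * (Real.sqrt 2 : ℂ) = 2 := by
      rw [← Complex.ofReal_mul, Real.mul_self_sqrt (by norm_num)]; norm_num
    field_simp
    rw [sq, h2]
  simp only [pexp, had, Real.cos_pi_div_four, Real.sin_pi_div_four, sgn_zero, one_smul]
  push_cast
  rw [h, mul_add, mul_smul_comm, mul_smul_comm, mul_one, smul_add, smul_smul, mul_comm Complex.I]

open Classical in
lemma mctrl_bop (c : ℕ) (V : Mat2) :
    mctrl c V = bop 0 (fun x => if Cut (fun i (x : BV c) => x i) x then V else 1) := by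
  ext f g
  simp only [mctrl, bop, add_zero]
  by_cases h : ini f = ini g
  · have hfg : (∀ i : Fin c, f i.castSucc = 1) ↔ (∀ i : Fin c, g i.castSucc = 1) :=
      forall_congr' fun i => by
        have := congrFun h i; simp only [ini] at this; rw [this]
    rw [if_pos h]
    by_cases hf : ∀ i : Fin c, f i.castSucc = 1
    · rw [if_pos ⟨hf, hfg.1 hf⟩, if_pos (show Cut (fun i (x : BV c) => x i) (ini f) from hf)]
    · rw [if_neg (fun q => hf q.1), if_neg (show ¬ Cut (fun i (x : BV c) => x i) (ini f) from hf), Matrix.one_apply]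
      have : f = g ↔ f (Fin.last c) = g (Fin.last c) :=
        ⟨fun h => by rw [h], fun h2 => funext fun i =>
          Fin.lastCases h2 (fun j => congrFun h j) i⟩
      simp only [this]
  · have hne : f ≠ g := fun q => h (by rw [q])
    rw [if_neg h, if_neg, if_neg hne]
    rintro ⟨h1, h2⟩
    exact h (funext fun i => (h1 i).trans (h2 i).symm)

lemma anti {s r : Mat2} (h₁ : s ∈ ({σX, σY, σZ} : Set Mat2)) (h₂ : r ∈ ({σX, σY, σZ} : Set Mat2))
    (hne : s ≠ r) : r * s = - (s * r) := by
  rcases h₁ with rfl | rfl | rfl <;> rcases h₂ with rfl | rfl | rfl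
  all_goals first
    | (exact absurd rfl hne)
    | (ext i j; fin_cases i <;> fin_cases j <;> simp [σX, σY, σZ]; done)

/-- Each additional control raises a Hadamard-like gate
`V = σ₁ · exp(i(π/4)σ₂)` one level in the Clifford Hierarchy: for every `c ≥ 1`, the
`c`-times-controlled gate `Cᶜ(V)` lies in `CH_{c+2}` on `c + 1` qubits. -/
theorem stmt16 (σ₁ σ₂ : Matrix (Fin 2) (Fin 2) ℂ)
    (h₁ : σ₁ ∈ ({σX, σY, σZ} : Set (Matrix (Fin 2) (Fin 2) ℂ)))
    (h₂ : σ₂ ∈ ({σX, σY, σZ} : Set (Matrix (Fin 2) (Fin 2) ℂ)))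
    (hne : σ₁ ≠ σ₂) (c : ℕ) (hc : 1 ≤ c) :
    mctrl c (σ₁ * pexp σ₂) ∈ CH (c + 1) (c + 2) := by
  have e1 : σ₁ ∈ pauliSet := by
    rcases h₁ with rfl | rfl | rfl <;> simp [pauliSet]
  have e2 : σ₂ ∈ pauliSet := by
    rcases h₂ with rfl | rfl | rfl <;> simp [pauliSet]
  have ha := anti h₁ h₂ hne
  rw [mctrl_bop, pexp_had]
  have := lev_A (c := c) σ₁ (Complex.I • (σ₁ * σ₂)) (G1.of e1)
    (((G1.of e1).mul (G1.of e2)).smul I_four) (pauli_star e1)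
    (by rw [star_smul, star_mul, pauli_star e1, pauli_star e2, ha]; simp)
    (by rw [smul_mul_assoc, mul_assoc, ha]; simp) c (fun i x => x i)
    (fun i x y => by simp) (fun _ => 0) (fun _ => 0) (Aff.const 0) (Aff.const 0) 1 pg_one
  rw [mul_one] at this
  exact this
end
end
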